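/- Let γ ≥ 1 and let T be a (3,γ)-hyperelliptic numerical semigroup of genus g; write u_1 = u_1(T) and χ = χ(T). Then the number of elements of T ∩ {1,…,2g} congruent to 3 − (u_1 mod 3) modulo 3 is at most γ + ⌈χ/3⌉. -/

import Mathlib

/-- A numerical semigroup: a subset of ℕ containing 0, closed under addition,
with finite complement. -/
def IsNumericalSemigroup (S : Set ℕ) : Prop :=
  0 ∈ S ∧ (∀ a ∈ S, ∀ b ∈ S, a + b ∈ S) ∧ Sᶜ.Finite

/-- The genus of a numerical semigroup: the number of gaps. -/
noncomputable def genus (S : Set ℕ) : ℕ := Sᶜ.ncard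

/-- The weight of a numerical semigroup of genus g: writing the gaps as
ℓ_1 < ⋯ < ℓ_g, it is Σ (ℓ_i − i) = (Σ ℓ_i) − g(g+1)/2. -/
noncomputable def weight (S : Set ℕ) : ℤ :=
  (∑ᶠ ℓ ∈ Sᶜ, (ℓ : ℤ)) - (genus S * (genus S + 1)) / 2

/-- S is (N,γ)-hyperelliptic: the γ smallest positive elements of S are
n_1 < ⋯ < n_γ, all multiples of N with n_γ = 2γN, and (2γ+1)N ∈ S. -/
def IsNgammaHyperelliptic (N γ : ℕ) (S : Set ℕ) : Prop :=
  IsNumericalSemigroup S ∧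
  {s ∈ S | 0 < s ∧ s ≤ 2 * γ * N}.ncard = γ ∧
  (∀ s ∈ S, 0 < s → s ≤ 2 * γ * N → N ∣ s) ∧
  2 * γ * N ∈ S ∧
  (2 * γ + 1) * N ∈ S

/-- u₁(S): the smallest positive element of S not divisible by 3. -/
noncomputable def u1 (S : Set ℕ) : ℕ := sInf {s ∈ S | ¬ 3 ∣ s}

/-- χ(S) = u₁(S) − (g − 3γ + 1 + ⌊(g mod 3)/2⌋), computed in ℤ. -/
noncomputable def chi (γ g : ℕ) (S : Set ℕ) : ℤ :=
  (u1 S : ℤ) - ((g : ℤ) - 3 * γ + 1 + ((g : ℤ) % 3) / 2)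

/-- S_i: the elements of S ∩ {1,…,2g} congruent to i modulo 3. -/
def resSet (g i : ℕ) (S : Set ℕ) : Set ℕ :=
  {s ∈ S | 1 ≤ s ∧ s ≤ 2 * g ∧ s % 3 = i}

/-- The inflection Ĩ_S = Σ_{s ∈ S ∩ {1,…,2g}} s. -/
noncomputable def inflection (g : ℕ) (S : Set ℕ) : ℕ :=
  ∑ᶠ s ∈ {s ∈ S | 1 ≤ s ∧ s ≤ 2 * g}, s

open Finset Classical in
/-- A positive non-element `m` of an additively closed set has at least `(m - 1) / 2` gaps
in `[1, m - 1]`, since `i` and `m - i` cannot both be elements. -/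
lemma sub_one_le_two_mul_card_gaps {S : Set ℕ} (hadd : ∀ a ∈ S, ∀ b ∈ S, a + b ∈ S) {m : ℕ}
    (hm : m ∉ S) : m - 1 ≤ 2 * #{i ∈ Ico 1 m | i ∉ S} := by
  have hle : #{i ∈ Ico 1 m | i ∈ S} ≤ #{i ∈ Ico 1 m | i ∉ S} := by
    refine card_le_card_of_injOn (fun i => m - i) ?_ ?_
    · intro i hi
      simp only [coe_filter, mem_Ico, Set.mem_ofPred_eq] at hi ⊢
      refine ⟨by omega, fun h => hm ?_⟩
      have := hadd _ hi.2 _ h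
      rwa [Nat.add_sub_cancel' hi.1.2.le] at this
    · intro i hi j hj hij
      simp only [coe_filter, mem_Ico, Set.mem_ofPred_eq] at hi hj hij
      omega
  have := card_filter_add_card_filter_not (s := Ico 1 m) (fun i => i ∈ S)
  rw [Nat.card_Ico] at this
  omega

/-- Every gap of a numerical semigroup of genus `g` is less than `2 * g`. -/
lemma IsNumericalSemigroup.lt_two_mul_genus {S : Set ℕ} (hS : IsNumericalSemigroup S) {m : ℕ}
    (hm : m ∉ S) : m < 2 * genus S := by
  classical
  obtain ⟨h0, hadd, hfin⟩ := hS
  have hpos : m ≠ 0 := by rintro rfl; exact hm h0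
  have h := sub_one_le_two_mul_card_gaps hadd hm
  have hlt : ({i ∈ Finset.Ico 1 m | i ∉ S} : Finset ℕ).card < genus S := by
    rw [genus, Set.ncard_eq_toFinset_card _ hfin]
    refine Finset.card_lt_card (Finset.ssubset_iff_subset_ne.2 ⟨fun i hi => ?_, fun he => ?_⟩)
    · simp only [Finset.mem_filter] at hi
      simpa using hi.2
    · have : m ∈ hfin.toFinset := by simpa using hm
      rw [← he] at this
      simp at this
  omega

open Finset in
lemma card_filter_Icc_mod_three (n r : ℕ) (hr : r = 1 ∨ r = 2) :
    #{i ∈ Icc 1 n | i % 3 = r} = (n + 3 - r) / 3 := by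
  induction n with
  | zero => simp; omega
  | succ n ih =>
    rw [← insert_Icc_right_eq_Icc_add_one (by omega), filter_insert]
    split_ifs with h
    · rw [card_insert_of_notMem (by simp), ih]
      omega
    · rw [ih]
      omega

open Finset Classical in
/-- At most `γ` gaps of a `(3,γ)`-hyperelliptic semigroup are multiples of `3`. -/
lemma IsNgammaHyperelliptic.card_gaps_three_dvd_le {γ : ℕ} {T : Set ℕ}
    (hT : IsNgammaHyperelliptic 3 γ T) (hfin : Tᶜ.Finite) :
    #{i ∈ hfin.toFinset | i % 3 = 0} ≤ γ := by
  obtain ⟨⟨h0, hadd, -⟩, hcard, hdvd, hmem, hmem'⟩ := hT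
  set A : Set ℕ := {m | 3 * m ∈ T} with hA
  have hAadd : ∀ a ∈ A, ∀ b ∈ A, a + b ∈ A := fun a ha b hb => by
    simpa [hA, mul_add] using hadd _ ha _ hb
  have hcardA : #{m ∈ Icc 1 (2 * γ) | m ∈ A} = γ := by
    rw [← hcard, ← Set.ncard_coe_finset,
      ← Set.ncard_image_of_injective _ (mul_right_injective₀ (three_ne_zero (α := ℕ)))]
    congr 1
    ext s
    simp only [coe_filter, mem_Icc, Set.mem_image, Set.mem_ofPred_eq]
    constructor
    · rintro ⟨m, ⟨hm, hmA⟩, rfl⟩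
      exact ⟨hmA, by omega, by omega⟩
    · rintro ⟨hs, hs0, hs1⟩
      obtain ⟨m, rfl⟩ := hdvd s hs hs0 hs1
      exact ⟨m, ⟨by omega, hs⟩, rfl⟩
  have hcardG : #{m ∈ Icc 1 (2 * γ) | m ∉ A} = γ := by
    have := card_filter_add_card_filter_not (s := Icc 1 (2 * γ)) (fun m => m ∈ A)
    rw [Nat.card_Icc] at this
    omega
  have hlarge : ∀ m, 2 * γ ≤ m → m ∈ A := by
    intro m
    induction m using Nat.strong_induction_on with
    | _ m ih =>
      intro hm
      by_contra hmA
      have h := sub_one_le_two_mul_card_gaps hAadd hmA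
      have hle : #{i ∈ Ico 1 m | i ∉ A} ≤ #{m ∈ Icc 1 (2 * γ) | m ∉ A} := by
        refine card_le_card fun i hi => ?_
        simp only [mem_filter, mem_Ico, mem_Icc] at hi ⊢
        refine ⟨⟨hi.1.1, ?_⟩, hi.2⟩
        by_contra hlt
        exact hi.2 (ih i hi.1.2 (by omega))
      have hm' : m = 2 * γ ∨ m = 2 * γ + 1 := by omega
      rcases hm' with rfl | rfl
      · exact hmA (by rwa [mul_comm] at hmem)
      · exact hmA (by rwa [mul_comm] at hmem')
  calc #{i ∈ hfin.toFinset | i % 3 = 0}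
      ≤ #(({m ∈ Icc 1 (2 * γ) | m ∉ A} : Finset ℕ).image (3 * ·)) := by
        refine card_le_card fun i hi => ?_
        simp only [mem_filter, Set.Finite.mem_toFinset, Set.mem_compl_iff] at hi
        obtain ⟨m, rfl⟩ := Nat.dvd_of_mod_eq_zero hi.2
        refine mem_image_of_mem _ (mem_filter.2 ⟨mem_Icc.2 ⟨?_, ?_⟩, hi.1⟩)
        · rcases Nat.eq_zero_or_pos m with rfl | h
          · exact absurd h0 hi.1
          · exact h
        · by_contra h
          exact hi.1 (hlarge m (by omega))
    _ ≤ γ := card_image_le.trans hcardG.le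

open Finset in
/-- The gaps congruent to an element `u` modulo `3` are either less than `u` or translates
by `u` of gaps divisible by `3`. -/
lemma card_gaps_mod_three_le {S : Set ℕ} (hadd : ∀ a ∈ S, ∀ b ∈ S, a + b ∈ S)
    (hfin : Sᶜ.Finite) {u : ℕ} (hu : u ∈ S) :
    #{i ∈ hfin.toFinset | i % 3 = u % 3} ≤ u / 3 + #{i ∈ hfin.toFinset | i % 3 = 0} := by
  calc #{i ∈ hfin.toFinset | i % 3 = u % 3}
      ≤ #((range (u / 3)).image (fun j => 3 * j + u % 3) ∪
          ({i ∈ hfin.toFinset | i % 3 = 0} : Finset ℕ).image (· + u)) := by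
        refine card_le_card fun i hi => ?_
        simp only [mem_filter, Set.Finite.mem_toFinset, Set.mem_compl_iff] at hi
        simp only [mem_union, mem_image, mem_range, mem_filter, Set.Finite.mem_toFinset,
          Set.mem_compl_iff]
        rcases lt_or_ge i u with h | h
        · exact Or.inl ⟨i / 3, by omega, by omega⟩
        · refine Or.inr ⟨i - u, ⟨fun hmem => hi.1 ?_, by omega⟩, by omega⟩
          simpa [Nat.sub_add_cancel h] using hadd _ hmem _ hu
    _ ≤ _ := (card_union_le _ _).trans
        (add_le_add (card_image_le.trans (card_range _).le) card_image_le)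

lemma IsNumericalSemigroup.u1_mem {S : Set ℕ} (hS : IsNumericalSemigroup S) :
    u1 S ∈ {s ∈ S | ¬ 3 ∣ s} := by
  refine Nat.sInf_mem ⟨3 * genus S + 1, ?_, by omega⟩
  by_contra h
  have := hS.lt_two_mul_genus h
  omega

open Finset in
/-- Elements and gaps in a nonzero residue class modulo `3` make up the class in `[1, 2g]`. -/
lemma IsNumericalSemigroup.ncard_resSet_add {S : Set ℕ} (hS : IsNumericalSemigroup S)
    (hfin : Sᶜ.Finite) (r : ℕ) (hr : r = 1 ∨ r = 2) :
    (resSet (genus S) r S).ncard + #{i ∈ hfin.toFinset | i % 3 = r} =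
      (2 * genus S + 3 - r) / 3 := by
  classical
  rw [← card_filter_Icc_mod_three _ r hr,
    ← card_filter_add_card_filter_not (s := {i ∈ Icc 1 (2 * genus S) | i % 3 = r}) (· ∈ S)]
  congr 1
  · rw [← Set.ncard_coe_finset]
    congr 1
    ext s
    simp only [resSet, coe_filter, mem_filter, mem_Icc, Set.mem_ofPred_eq]
    tauto
  · congr 1
    ext s
    simp only [mem_filter, mem_Icc, Set.Finite.mem_toFinset, Set.mem_compl_iff]
    constructor
    · rintro ⟨hs, hsr⟩
      have := hS.lt_two_mul_genus hs
      exact ⟨⟨by omega, hsr⟩, hs⟩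
    · tauto

/-- #T_{3−(u₁ mod 3)} ≤ γ + ⌈χ/3⌉. -/
theorem stmt4 (γ g : ℕ) (hγ : 1 ≤ γ) (T : Set ℕ)
    (hT : IsNgammaHyperelliptic 3 γ T) (hg : genus T = g) :
    ((resSet g (3 - u1 T % 3) T).ncard : ℤ) ≤ (γ : ℤ) + ⌈(chi γ g T : ℚ) / 3⌉ := by
  classical
  subst hg
  have hS := hT.1
  obtain ⟨-, hadd, hfin⟩ := hT.1
  obtain ⟨huT, hu3⟩ := hS.u1_mem
  have h0 := hT.card_gaps_three_dvd_le hfin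
  have hu := card_gaps_mod_three_le hadd hfin huT
  have hr := hS.ncard_resSet_add hfin (3 - u1 T % 3) (by omega)
  have hsum : genus T = ∑ r ∈ Finset.range 3, (hfin.toFinset.filter (· % 3 = r)).card := by
    rw [genus, Set.ncard_eq_toFinset_card _ hfin]
    exact Finset.card_eq_sum_card_fiberwise fun i _ => by
      simpa using Nat.mod_lt i three_pos
  simp only [Finset.sum_range_succ, Finset.sum_range_zero, zero_add] at hsum
  rw [← sub_le_iff_le_add', Int.le_ceil_iff, lt_div_iff₀ (by norm_num)]
  have key : (((resSet (genus T) (3 - u1 T % 3) T).ncard : ℤ) - γ - 1) * 3 < chi γ (genus T) T := by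
    rw [chi]
    have hmod : u1 T % 3 = 1 ∨ u1 T % 3 = 2 := by omega
    rcases hmod with h | h <;> simp only [h, Nat.reduceSub] at hu hr ⊢ <;> omega
  exact_mod_cast key
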